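/- Let m,n,p ≥ 3 and let R be the DFA over alphabet {a,b} obtained as the product of the catenation DFA X_m(a,b,−;∅)·X_n(a,−,b;∅) with X_p(b,a,−;∅); the states of R are triples (i,S,k) with 0 ≤ i ≤ m−1, S ⊆ {0,…,n−1}, 0 ≤ k ≤ p−1. Then every state (i,S,k) satisfying the condition (i = m−1 implies 0 ∈ S) is reachable from the initial state of R. -/

import Mathlib

/-- The cyclic permutation `i ↦ i+1 mod n` on `{0,…,n−1}`. -/
def cyc {n : ℕ} (i : Fin n) : Fin n := ⟨(i.val + 1) % n, Nat.mod_lt _ i.pos⟩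

/-- The transposition exchanging `0` and `1` and fixing all other elements of `{0,…,n−1}`. -/
def transp {n : ℕ} (i : Fin n) : Fin n :=
  if i.val = 0 then ⟨1 % n, Nat.mod_lt _ i.pos⟩
  else if i.val = 1 then ⟨0, i.pos⟩ else i

/-- The contraction sending `1` to `0` and fixing all other elements of `{0,…,n−1}`. -/
def contr {n : ℕ} (i : Fin n) : Fin n := if i.val = 1 then ⟨0, i.pos⟩ else i

/-- A Brzozowski-type complete DFA: state set `{0,…,n−1}`, initial state `0`,
unique final state `n−1`, where each letter `x` acts as the transformation `f x`. -/
def brzDFA {α : Type} (n : ℕ) (hn : 0 < n) (f : α → Fin n → Fin n) : DFA α (Fin n) where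
  step q x := f x q
  start := ⟨0, hn⟩
  accept := {⟨n - 1, Nat.sub_lt hn Nat.one_pos⟩}

/-- Product DFA of two DFAs, with acceptance given by applying the boolean
connective `o` to the two components' acceptance. -/
def prodDFA {α σB σC : Type} (B : DFA α σB) (C : DFA α σC) (o : Prop → Prop → Prop) :
    DFA α (σB × σC) where
  step q x := (B.step q.1 x, C.step q.2 x)
  start := (B.start, C.start)
  accept := {q | o (q.1 ∈ B.accept) (q.2 ∈ C.accept)}

open Classical in
/-- Catenation DFA of two DFAs. -/
noncomputable def catDFA {α σA σM : Type} (A : DFA α σA) (M : DFA α σM) :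
    DFA α (σA × Set σM) where
  step q x :=
    (A.step q.1 x,
      if A.step q.1 x ∈ A.accept then (fun s => M.step s x) '' q.2 ∪ {M.start}
      else (fun s => M.step s x) '' q.2)
  start := (A.start, if A.start ∈ A.accept then {M.start} else ∅)
  accept := {q | (q.2 ∩ M.accept).Nonempty}

/-- Two states of a DFA are equivalent if no word separates them. -/
def equivStates {α σ : Type} (D : DFA α σ) (q₁ q₂ : σ) : Prop :=
  ∀ w : List α, (D.evalFrom q₁ w ∈ D.accept ↔ D.evalFrom q₂ w ∈ D.accept)

/-- The two-letter alphabet `{a,b}`. -/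
inductive Two | a | b

/-- `X_m(a,b,−;∅)`: `a` the cycle, `b` the transposition. -/
def ZA (m : ℕ) (hm : 0 < m) : DFA Two (Fin m) :=
  brzDFA m hm (fun x q => match x with | Two.a => cyc q | Two.b => transp q)

/-- `X_n(a,−,b;∅)`: `a` the cycle, `b` the contraction. -/
def ZB (n : ℕ) (hn : 0 < n) : DFA Two (Fin n) :=
  brzDFA n hn (fun x q => match x with | Two.a => cyc q | Two.b => contr q)

/-- `X_p(b,a,−;∅)`: `b` the cycle, `a` the transposition. -/
def ZC (p : ℕ) (hp : 0 < p) : DFA Two (Fin p) :=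
  brzDFA p hp (fun x q => match x with | Two.a => transp q | Two.b => cyc q)

theorem cyc_injective {n : ℕ} : Function.Injective (cyc : Fin n → Fin n) := by
  intro x y h
  have hxy : (x.val + 1) % n = (y.val + 1) % n := congrArg Fin.val h
  have h' : x.val ≡ y.val [MOD n] := Nat.ModEq.add_right_cancel' 1 hxy
  exact Fin.ext (Nat.ModEq.eq_of_lt_of_lt h' x.isLt y.isLt)

theorem cyc_surjective {n : ℕ} : Function.Surjective (cyc : Fin n → Fin n) :=
  Finite.injective_iff_surjective.mp cyc_injective

theorem cyc_val_of_lt {n : ℕ} (x : Fin n) (h : x.val + 1 < n) : (cyc x).val = x.val + 1 :=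
  Nat.mod_eq_of_lt h

theorem cyc_val_of_eq {n : ℕ} (x : Fin n) (h : x.val + 1 = n) : (cyc x).val = 0 := by
  simp [cyc, h]

theorem cyc_iterate_val {n : ℕ} (x : Fin n) (j : ℕ) : (cyc^[j] x).val = (x.val + j) % n := by
  induction j with
  | zero => exact (Nat.mod_eq_of_lt x.isLt).symm
  | succ j ih =>
    rw [Function.iterate_succ_apply']
    change ((cyc^[j] x).val + 1) % n = _
    rw [ih, Nat.mod_add_mod, Nat.add_assoc]

theorem exists_cyc_iterate_eq {n : ℕ} (x y : Fin n) : ∃ j, cyc^[j] x = y := by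
  refine ⟨y.val + (n - x.val), Fin.ext ?_⟩
  have hx := x.isLt
  rw [cyc_iterate_val, show x.val + (y.val + (n - x.val)) = y.val + n by omega,
    Nat.add_mod_right, Nat.mod_eq_of_lt y.isLt]

theorem image_cyc_preimage {n : ℕ} (S : Set (Fin n)) : cyc '' (cyc ⁻¹' S) = S :=
  Set.image_preimage_eq S cyc_surjective

theorem ncard_preimage_cyc {n : ℕ} (S : Set (Fin n)) : (cyc ⁻¹' S).ncard = S.ncard := by
  conv_rhs => rw [← image_cyc_preimage S]
  exact (Set.ncard_image_of_injective _ cyc_injective).symm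

theorem contr_image_eq_self {n : ℕ} {S : Set (Fin n)} (h : ∀ x ∈ S, x.val ≠ 1) :
    contr '' S = S := by
  have : Set.EqOn contr id S := fun x hx => by simp [contr, h x hx]
  rw [this.image_eq, Set.image_id]

theorem transp_transp {n : ℕ} (hn : 2 ≤ n) (x : Fin n) : transp (transp x) = x := by
  have h1 : 1 % n = 1 := Nat.mod_eq_of_lt (by omega)
  apply Fin.ext
  simp only [transp, h1]
  split_ifs <;> simp_all

/-- A property of pairs `(i, S)` that holds at `(0, ∅)` and is preserved by the moves of the
catenation automaton holds at every pair with `0 ∈ S` whenever `i = m - 1`. -/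
theorem catenation_induction {m n : ℕ} (hm : 3 ≤ m) (hn : 3 ≤ n)
    (P : Fin m → Set (Fin n) → Prop)
    (h0 : P ⟨0, by omega⟩ ∅)
    (ha : ∀ i S, (cyc i).val ≠ m - 1 → P i S → P (cyc i) (cyc '' S))
    (ha' : ∀ i S, (cyc i).val = m - 1 → P i S → P (cyc i) (cyc '' S ∪ {⟨0, by omega⟩}))
    (hb : ∀ S, P ⟨1, by omega⟩ S → P ⟨0, by omega⟩ (contr '' S))
    (i : Fin m) (S : Set (Fin n)) (hS : i.val = m - 1 → (⟨0, by omega⟩ : Fin n) ∈ S) :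
    P i S := by
  induction hs : S.ncard using Nat.strong_induction_on generalizing i S with
  | _ s ih =>
  subst hs
  have last (T : Set (Fin n)) (hT : T.ncard = S.ncard) (h : (⟨0, by omega⟩ : Fin n) ∈ T) :
      P ⟨m - 1, by omega⟩ T := by
    let U : Set (Fin n) := cyc ⁻¹' (T \ {⟨0, by omega⟩})
    have hU : U.ncard < S.ncard := by
      rw [ncard_preimage_cyc, ← hT]
      exact Set.ncard_sdiff_singleton_lt_of_mem h
    have hc : cyc (⟨m - 2, by omega⟩ : Fin m) = ⟨m - 1, by omega⟩ := by
      apply Fin.ext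
      rw [cyc_val_of_lt _ (by simp only; omega)]
      simp only
      omega
    have := ha' ⟨m - 2, by omega⟩ U (by rw [hc])
      (ih _ hU _ U (fun e => by simp only at e; omega) rfl)
    rwa [hc, image_cyc_preimage, Set.sdiff_union_self,
      Set.union_eq_self_of_subset_right (Set.singleton_subset_iff.mpr h)] at this
  have zero_of_one_mem (T : Set (Fin n)) (hT : T.ncard = S.ncard)
      (h : (⟨1, by omega⟩ : Fin n) ∈ T) : P ⟨0, by omega⟩ T := by
    have hc : cyc (⟨m - 1, by omega⟩ : Fin m) = ⟨0, by omega⟩ :=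
      Fin.ext (cyc_val_of_eq _ (by simp only; omega))
    have hc' : cyc (⟨0, by omega⟩ : Fin n) = ⟨1, by omega⟩ :=
      Fin.ext (cyc_val_of_lt _ (by simp only; omega))
    have := ha ⟨m - 1, by omega⟩ (cyc ⁻¹' T) (by rw [hc]; simp only; omega)
      (last _ ((ncard_preimage_cyc T).trans hT) (by rwa [Set.mem_preimage, hc']))
    rwa [hc, image_cyc_preimage] at this
  have zero_of_iterate_mem (j : ℕ) : ∀ T : Set (Fin n), T.ncard = S.ncard →
      cyc^[j] ⟨1, by omega⟩ ∈ T → P ⟨0, by omega⟩ T := by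
    induction j with
    | zero => exact zero_of_one_mem
    | succ j ihj =>
      intro T hT h
      by_cases h1 : (⟨1, by omega⟩ : Fin n) ∈ T
      · exact zero_of_one_mem T hT h1
      rw [Function.iterate_succ_apply'] at h
      have hc : cyc (⟨0, by omega⟩ : Fin m) = ⟨1, by omega⟩ :=
        Fin.ext (cyc_val_of_lt _ (by simp only; omega))
      have h2 := ha ⟨0, by omega⟩ (cyc ⁻¹' T) (by rw [hc]; simp only; omega)
        (ihj _ ((ncard_preimage_cyc T).trans hT) h)
      rw [hc, image_cyc_preimage] at h2
      have h3 := hb T h2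
      rwa [contr_image_eq_self] at h3
      intro x hx e
      exact h1 ((Fin.ext e : x = ⟨1, by omega⟩) ▸ hx)
  have zero (T : Set (Fin n)) (hT : T.ncard = S.ncard) : P ⟨0, by omega⟩ T := by
    rcases T.eq_empty_or_nonempty with rfl | ⟨x, hx⟩
    · exact h0
    · obtain ⟨j, hj⟩ := exists_cyc_iterate_eq (⟨1, by omega⟩ : Fin n) x
      exact zero_of_iterate_mem j T hT (hj ▸ hx)
  have below (l : ℕ) : ∀ (hl : l < m - 1) (T : Set (Fin n)), T.ncard = S.ncard →
      P ⟨l, by omega⟩ T := by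
    induction l with
    | zero => exact fun _ => zero
    | succ l ihl =>
      intro hl T hT
      have hc : cyc (⟨l, by omega⟩ : Fin m) = ⟨l + 1, by omega⟩ :=
        Fin.ext (cyc_val_of_lt _ (by simp only; omega))
      have := ha ⟨l, by omega⟩ (cyc ⁻¹' T) (by rw [hc]; simp only; omega)
        (ihl (by omega) _ ((ncard_preimage_cyc T).trans hT))
      rwa [hc, image_cyc_preimage] at this
  by_cases hi : i.val = m - 1
  · have := last S rfl (hS hi)
    rwa [← (Fin.ext hi : i = ⟨m - 1, by omega⟩)] at this
  · exact below i.val (by omega) S rfl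

/-- A property of `Fin p` that holds at `0` and is preserved by `k ↦ k + 2` and by the
transposition followed by the cycle holds everywhere. -/
theorem cyc_transp_induction {p : ℕ} (hp : 3 ≤ p) (K : Fin p → Prop) (h0 : K ⟨0, by omega⟩)
    (hbb : ∀ k, K k → K (cyc (cyc k))) (hab : ∀ k, K k → K (cyc (transp k))) (k : Fin p) :
    K k := by
  have h1p : 1 % p = 1 := Nat.mod_eq_of_lt (by omega)
  have two_le (l : ℕ) : ∀ h : l + 2 < p, K ⟨l + 2, h⟩ := by
    induction l with
    | zero =>
      intro h
      convert hab _ h0 using 1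
      apply Fin.ext
      simp [transp, cyc, h1p, Nat.mod_eq_of_lt h]
    | succ l ih =>
      intro h
      convert hab _ (ih (by omega)) using 1
      apply Fin.ext
      simp [transp, cyc, Nat.mod_eq_of_lt h]
  rcases k with ⟨_ | _ | l, hk⟩
  · exact h0
  · have hlast := two_le (p - 3) (by omega)
    convert hbb _ hlast using 1
    apply Fin.ext
    simp [cyc, show p - 3 + 2 + 1 = p by omega, h1p]
  · exact two_le l hk

theorem statement17 (m n p : ℕ) (hm : 3 ≤ m) (hn : 3 ≤ n) (hp : 3 ≤ p)
    (i : Fin m) (S : Set (Fin n)) (k : Fin p)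
    (hS : i.val = m - 1 → (⟨0, by omega⟩ : Fin n) ∈ S) :
    ∃ w : List Two,
      (prodDFA (catDFA (ZA m (by omega)) (ZB n (by omega))) (ZC p (by omega)) Or).evalFrom
        (prodDFA (catDFA (ZA m (by omega)) (ZB n (by omega))) (ZC p (by omega)) Or).start w
      = ((i, S), k) := by
  set D := prodDFA (catDFA (ZA m (by omega)) (ZB n (by omega))) (ZC p (by omega)) Or with hD
  let Reach (q : (Fin m × Set (Fin n)) × Fin p) : Prop := ∃ w, D.evalFrom D.start w = q
  have step (q) (x : Two) (h : Reach q) : Reach (D.step q x) := by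
    obtain ⟨w, rfl⟩ := h
    exact ⟨w ++ [x], D.evalFrom_append_singleton _ _ _⟩
  have stepA (i : Fin m) (S : Set (Fin n)) (k : Fin p) (hi : (cyc i).val ≠ m - 1)
      (h : Reach ((i, S), k)) : Reach ((cyc i, cyc '' S), transp k) := by
    convert step _ Two.a h using 1
    simp [hD, prodDFA, catDFA, ZA, ZB, ZC, brzDFA, Fin.ext_iff, hi]
  have stepA' (i : Fin m) (S : Set (Fin n)) (k : Fin p) (hi : (cyc i).val = m - 1)
      (h : Reach ((i, S), k)) :
      Reach ((cyc i, cyc '' S ∪ {⟨0, by omega⟩}), transp k) := by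
    convert step _ Two.a h using 1
    simp [hD, prodDFA, catDFA, ZA, ZB, ZC, brzDFA, Fin.ext_iff, hi]
  have stepB (i : Fin m) (S : Set (Fin n)) (k : Fin p) (hi : (transp i).val ≠ m - 1)
      (h : Reach ((i, S), k)) : Reach ((transp i, contr '' S), cyc k) := by
    convert step _ Two.b h using 1
    simp [hD, prodDFA, catDFA, ZA, ZB, ZC, brzDFA, Fin.ext_iff, hi]
  have start : Reach ((⟨0, by omega⟩, ∅), ⟨0, by omega⟩) := by
    refine ⟨[], ?_⟩
    simp [hD, prodDFA, catDFA, ZA, ZB, ZC, brzDFA, Fin.ext_iff, show 0 ≠ m - 1 by omega]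
  have cyc0 : cyc (⟨0, by omega⟩ : Fin m) = ⟨1, by omega⟩ :=
    Fin.ext (cyc_val_of_lt _ (by simp only; omega))
  have transp0 : transp (⟨0, by omega⟩ : Fin m) = ⟨1, by omega⟩ :=
    Fin.ext (by simpa [transp] using Nat.mod_eq_of_lt (by omega))
  have transp1 : transp (⟨1, by omega⟩ : Fin m) = ⟨0, by omega⟩ := by simp [transp]
  have swapBack (S : Set (Fin n)) (k : Fin p) (h : Reach ((⟨1, by omega⟩, S), k)) :
      Reach ((⟨0, by omega⟩, contr '' S), cyc k) := by
    simpa only [transp1] using stepB _ S k (by rw [transp1]; simp only; omega) h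
  refine catenation_induction hm hn (fun i S => ∀ k, Reach ((i, S), k)) ?_ ?_ ?_ ?_ i S hS k
  · refine cyc_transp_induction hp _ start (fun k h => ?_) (fun k h => ?_)
    · have h1 := stepB _ _ _ (by rw [transp0]; simp only; omega) h
      rw [transp0] at h1
      simpa only [Set.image_empty] using swapBack _ _ h1
    · have h1 := stepA _ _ _ (by rw [cyc0]; simp only; omega) h
      rw [cyc0] at h1
      simpa only [Set.image_empty] using swapBack _ _ h1
  · intro i S hi h k
    simpa only [transp_transp (by omega : 2 ≤ p)] using stepA i S _ hi (h (transp k))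
  · intro i S hi h k
    simpa only [transp_transp (by omega : 2 ≤ p)] using stepA' i S _ hi (h (transp k))
  · intro S h k
    obtain ⟨k, rfl⟩ := cyc_surjective k
    exact swapBack S k (h k)
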